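/- Let α ∈ (0,1) and 1 ≤ p, q ≤ ∞ (with the convention 1/∞ = 0). There exists a unique holomorphic function φ : S → ℂ satisfying Im φ(iα) = 0 and Re φ(x + iy) = (1/p)(𝓟_y ∗ log(𝓟_α/(1−α)))(x) + (1/q)(𝓟_{1−y} ∗ log(𝓟_{1−α}/α))(x) for all x + iy ∈ S, where ∗ denotes convolution on ℝ. Moreover, sup over x + iy ∈ S of | Re φ(x + iy) + π((1−y)/p + y/q)·|x| | is finite. -/

import Mathlib

open MeasureTheory Complex Filter Set
open scoped Real ENNReal Topology

noncomputable section

def Strip : Set ℂ := {z : ℂ | 0 < z.im ∧ z.im < 1}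

def bLine (h : ℂ → ℂ) (y : ℝ) : ℝ → ℂ := fun x => h (x + y * Complex.I)

def hardyNorm (p q : ℝ≥0∞) (h : ℂ → ℂ) : ℝ≥0∞ :=
  ⨆ y ∈ Set.Ioo (0:ℝ) 1,
    ⨅ (f : ℝ → ℂ) (g : ℝ → ℂ) (_ : Measurable f) (_ : Measurable g)
      (_ : f + g = bLine h y),
      ENNReal.ofReal (1 - y)⁻¹ * eLpNorm f p volume +
        ENNReal.ofReal y⁻¹ * eLpNorm g q volume

def MemHardy (p q : ℝ≥0∞) (h : ℂ → ℂ) : Prop :=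
  DifferentiableOn ℂ h Strip ∧ hardyNorm p q h < ⊤

def IsTrace0 (h : ℂ → ℂ) (v : ℝ → ℂ) : Prop :=
  ∀ φ : SchwartzMap ℝ ℂ,
    Tendsto (fun y : ℝ => ∫ x : ℝ, h (x + y * Complex.I) * (starRingEnd ℂ) (φ x))
      (𝓝[>] (0:ℝ)) (𝓝 (∫ x : ℝ, v x * (starRingEnd ℂ) (φ x)))

def IsTrace1 (h : ℂ → ℂ) (w : ℝ → ℂ) : Prop :=
  ∀ φ : SchwartzMap ℝ ℂ,
    Tendsto (fun y : ℝ => ∫ x : ℝ, h (x + y * Complex.I) * (starRingEnd ℂ) (φ x))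
      (𝓝[<] (1:ℝ)) (𝓝 (∫ x : ℝ, w x * (starRingEnd ℂ) (φ x)))

/-- The Poisson kernel of the strip. -/
def Pker (y x : ℝ) : ℝ :=
  Real.sin (Real.pi * y) / (2 * (Real.cosh (Real.pi * x) - Real.cos (Real.pi * y)))

/-- The Poisson-integral formula for the real part of the phase function `φ_{α,p,q}`. -/
def ReFormula (p q : ℝ≥0∞) (α : ℝ) (φ : ℂ → ℂ) : Prop :=
  ∀ x y : ℝ, y ∈ Set.Ioo (0:ℝ) 1 →
    (φ ((x : ℂ) + (y : ℂ) * Complex.I)).re =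
      (p⁻¹).toReal * (∫ w : ℝ, Pker y (x - w) * Real.log (Pker α w / (1 - α))) +
      (q⁻¹).toReal * (∫ w : ℝ, Pker (1 - y) (x - w) * Real.log (Pker (1 - α) w / α))

lemma exp_abs_le_cosh (t : ℝ) : Real.exp |t| / 2 ≤ Real.cosh t := by
  rw [← Real.cosh_abs, Real.cosh_eq]
  have := Real.exp_pos (-|t|)
  linarith

lemma cosh_le_exp_abs (t : ℝ) : Real.cosh t ≤ Real.exp |t| := by
  rw [← Real.cosh_abs, Real.cosh_eq]
  have : Real.exp (-|t|) ≤ Real.exp |t| := Real.exp_le_exp.2 (by linarith [abs_nonneg t])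
  linarith

lemma integrable_expabs (c : ℝ) (hc : 0 < c) :
    Integrable (fun x : ℝ => Real.exp (-c * |x|)) := by
  rw [← integrableOn_univ, ← Set.Iic_union_Ioi (a := (0:ℝ)), integrableOn_union]
  constructor
  · refine (integrableOn_exp_mul_Iic hc 0).congr_fun ?_ measurableSet_Iic
    intro x hx
    simp only [abs_of_nonpos (Set.mem_Iic.1 hx)]; ring_nf
  · refine (integrableOn_exp_mul_Ioi (neg_lt_zero.2 hc) 0).congr_fun ?_ measurableSet_Ioi
    intro x hx
    simp only [abs_of_pos (Set.mem_Ioi.1 hx)]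

lemma N_ge {e y : ℝ} (he : e ≤ 1 - |Real.cos (π * y)|) (x : ℝ) :
    e * Real.cosh (π * x) ≤ Real.cosh (π * x) - Real.cos (π * y) := by
  have h1 := Real.one_le_cosh (π * x)
  have h2 := le_abs_self (Real.cos (π * y))
  have h3 := abs_nonneg (Real.cos (π * y))
  nlinarith

lemma N_ge_exp {e y : ℝ} (he0 : 0 < e) (he : e ≤ 1 - |Real.cos (π * y)|) (x : ℝ) :
    e / 2 * Real.exp (π * |x|) ≤ Real.cosh (π * x) - Real.cos (π * y) := by
  have h1 := N_ge he x
  have h2 := exp_abs_le_cosh (π * x)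
  rw [abs_mul, abs_of_pos Real.pi_pos] at h2
  nlinarith

lemma abs_cos_lt {y : ℝ} (hy : y ∈ Set.Ioo (0:ℝ) 1) : 0 < 1 - |Real.cos (π * y)| := by
  have hs : 0 < Real.sin (π * y) := Real.sin_pos_of_pos_of_lt_pi
    (mul_pos Real.pi_pos hy.1) (by nlinarith [Real.pi_pos, hy.2])
  have h := Real.sin_sq_add_cos_sq (π * y)
  rw [← sq_abs (Real.cos _)] at h
  nlinarith [abs_nonneg (Real.cos (π * y))]

lemma sinpos {y : ℝ} (hy : y ∈ Set.Ioo (0:ℝ) 1) : 0 < Real.sin (π * y) :=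
  Real.sin_pos_of_pos_of_lt_pi
    (mul_pos Real.pi_pos hy.1) (by nlinarith [Real.pi_pos, hy.2])

lemma N_pos {y : ℝ} (hy : y ∈ Set.Ioo (0:ℝ) 1) (x : ℝ) :
    0 < Real.cosh (π * x) - Real.cos (π * y) := by
  have := N_ge_exp (abs_cos_lt hy) le_rfl x
  have h2 := abs_cos_lt hy
  have h3 := Real.exp_pos (π * |x|)
  nlinarith [mul_pos h2 h3]

lemma Pker_pos {y : ℝ} (hy : y ∈ Set.Ioo (0:ℝ) 1) (x : ℝ) : 0 < Pker y x := by
  have := N_pos hy x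
  exact div_pos (sinpos hy) (by linarith)

lemma Pker_cont {y : ℝ} (hy : y ∈ Set.Ioo (0:ℝ) 1) : Continuous (Pker y) := by
  unfold Pker
  refine Continuous.div (by fun_prop) (by fun_prop) ?_
  intro x
  have := N_pos hy x
  positivity

lemma Pker_le {y : ℝ} (hy : y ∈ Set.Ioo (0:ℝ) 1) (x : ℝ) :
    Pker y x ≤ (1 - |Real.cos (π * y)|)⁻¹ * Real.exp (-π * |x|) := by
  unfold Pker
  have h := N_ge_exp (abs_cos_lt hy) le_rfl x
  have h2 := abs_cos_lt hy
  have hN := N_pos hy x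
  rw [div_le_iff₀ (by linarith)]
  have hs := Real.sin_le_one (π * y)
  have e1 : Real.exp (-π * |x|) * Real.exp (π * |x|) = 1 := by
    rw [← Real.exp_add]; simp
  set e := 1 - |Real.cos (π * y)|
  have : e⁻¹ * Real.exp (-π * |x|) * (2 * (e / 2 * Real.exp (π * |x|))) = 1 := by
    have : e⁻¹ * e = 1 := inv_mul_cancel₀ h2.ne'
    calc _ = (e⁻¹ * e) * (Real.exp (-π * |x|) * Real.exp (π * |x|)) := by ring
      _ = 1 := by rw [this, e1, one_mul]
  have h3 : 0 ≤ e⁻¹ * Real.exp (-π * |x|) := by positivity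
  nlinarith [mul_le_mul_of_nonneg_left h h3]

lemma Pker_integrable {y : ℝ} (hy : y ∈ Set.Ioo (0:ℝ) 1) : Integrable (Pker y) := by
  refine ((integrable_expabs π Real.pi_pos).const_mul ((1 - |Real.cos (π * y)|)⁻¹)).mono'
    (Pker_cont hy).aestronglyMeasurable (ae_of_all _ fun x => ?_)
  rw [Real.norm_of_nonneg (Pker_pos hy x).le]
  exact Pker_le hy x

lemma Pker_integral {y : ℝ} (hy : y ∈ Set.Ioo (0:ℝ) 1) : ∫ x, Pker y x = 1 - y := by
  have hs := sinpos hy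
  have hd : ∀ x, HasDerivAt (fun x => (1 / π) * Real.arctan
      ((Real.exp (π * x) - Real.cos (π * y)) / Real.sin (π * y))) (Pker y x) x := by
    intro x
    have h0 : HasDerivAt (fun x : ℝ => (Real.exp (π * x) - Real.cos (π * y)) / Real.sin (π * y))
        ((Real.exp (π * x) * (π * 1)) / Real.sin (π * y)) x :=
      ((((hasDerivAt_id x).const_mul π).exp).sub_const _).div_const _
    have h1 := (h0.arctan).const_mul (1 / π)
    refine h1.congr_deriv (Eq.symm ?_)
    unfold Pker
    have hN := N_pos hy x
    have hc := Real.sin_sq_add_cos_sq (π * y)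
    rw [Real.cosh_eq] at hN ⊢
    have he : Real.exp (-(π * x)) = (Real.exp (π * x))⁻¹ := Real.exp_neg _
    rw [he] at hN ⊢
    have hE := Real.exp_pos (π * x)
    set E := Real.exp (π * x)
    set s := Real.sin (π * y)
    set c := Real.cos (π * y)
    have hpi := Real.pi_pos
    have h3 : 1 + ((E - c) / s) ^ 2 = 2 * E * ((E + E⁻¹) / 2 - c) / s ^ 2 := by
      field_simp
      linear_combination hc
    rw [h3]
    have := hN.ne'
    generalize (E + E⁻¹) / 2 - c = M at *
    field_simp
  have htop : Tendsto (fun x => (1 / π) * Real.arctan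
      ((Real.exp (π * x) - Real.cos (π * y)) / Real.sin (π * y))) atTop (𝓝 ((1/π) * (π/2))) := by
    refine Tendsto.const_mul _ ?_
    refine (tendsto_nhds_of_tendsto_nhdsWithin Real.tendsto_arctan_atTop).comp ?_
    refine Tendsto.atTop_div_const hs ?_
    refine tendsto_atTop_add_const_right _ _ ?_
    exact Real.tendsto_exp_atTop.comp (tendsto_id.const_mul_atTop Real.pi_pos)
  have hbot : Tendsto (fun x => (1 / π) * Real.arctan
      ((Real.exp (π * x) - Real.cos (π * y)) / Real.sin (π * y))) atBot
      (𝓝 ((1/π) * (π * y - π/2))) := by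
    refine Tendsto.const_mul _ ?_
    have h : π * y - π / 2 = Real.arctan ((0 - Real.cos (π * y)) / Real.sin (π * y)) := by
      have : (0 - Real.cos (π * y)) / Real.sin (π * y) = Real.tan (π * y - π / 2) := by
        rw [Real.tan_eq_sin_div_cos, Real.sin_sub_pi_div_two, Real.cos_sub_pi_div_two, zero_sub]
      rw [this, Real.arctan_tan]
      · nlinarith [Real.pi_pos, hy.1]
      · nlinarith [Real.pi_pos, hy.2]
    rw [h]
    refine (Real.continuous_arctan.tendsto _).comp ?_
    refine Tendsto.div_const ?_ _
    refine Tendsto.sub_const ?_ _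
    exact Real.tendsto_exp_atBot.comp (tendsto_id.const_mul_atBot Real.pi_pos)
  rw [integral_of_hasDerivAt_of_tendsto hd (Pker_integrable hy) hbot htop]
  have := Real.pi_pos
  field_simp
  ring

lemma mul_Pker_le {y : ℝ} (hy : y ∈ Set.Ioo (0:ℝ) 1) (x : ℝ) :
    |x| * Pker y x ≤ (1 / π) * Real.exp (-(π / 4) * |x|) := by
  have hN := N_pos hy x
  unfold Pker
  rw [← mul_div_assoc, div_le_iff₀ (by linarith)]
  have hs2 : Real.sin (π * y) = 2 * Real.sin (π * y / 2) * Real.cos (π * y / 2) := by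
    rw [← Real.sin_two_mul]; ring_nf
  have hc2 : Real.cos (π * y) = 1 - 2 * Real.sin (π * y / 2) ^ 2 := by
    have := Real.cos_two_mul (π * y / 2)
    rw [show 2 * (π * y / 2) = π * y by ring] at this
    rw [this, Real.cos_sq']; ring
  have hs0 : 0 < Real.sin (π * y / 2) := Real.sin_pos_of_pos_of_lt_pi
    (by have := mul_pos Real.pi_pos hy.1; linarith) (by nlinarith [Real.pi_pos, hy.2])
  have hc1 := Real.cos_le_one (π * y / 2)
  set t := π * |x| / 2 with ht
  have ht0 : 0 ≤ t := by positivity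
  have hch : Real.cosh (π * x) = 1 + 2 * Real.sinh t ^ 2 := by
    rw [← Real.cosh_abs, abs_mul, abs_of_pos Real.pi_pos, show π * |x| = 2 * t by rw [ht]; ring,
      Real.cosh_two_mul, Real.cosh_sq]; ring
  have hS : t * Real.exp (t / 2) / 2 ≤ Real.sinh t := by
    have : Real.sinh t = 2 * Real.sinh (t / 2) * Real.cosh (t / 2) := by
      rw [← Real.sinh_two_mul]; ring_nf
    rw [this]
    have a1 : t / 2 ≤ Real.sinh (t / 2) := Real.self_le_sinh_iff.2 (by linarith)
    have a2 := exp_abs_le_cosh (t / 2)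
    rw [abs_of_nonneg (by linarith : 0 ≤ t / 2)] at a2
    have := mul_le_mul a1 a2 (by positivity) (by linarith)
    linarith
  have hE : Real.exp (-(π / 4) * |x|) * Real.exp (t / 2) = 1 := by
    rw [← Real.exp_add, ht]; ring_nf; simp
  have hE0 := Real.exp_pos (-(π / 4) * |x|)
  rw [hs2, hc2, hch]
  generalize Real.exp (-(π / 4) * |x|) = E at *
  generalize Real.exp (t / 2) = F at *
  generalize Real.sinh t = S at *
  generalize Real.sin (π * y / 2) = s at *
  generalize Real.cos (π * y / 2) = c at *
  have b1 : 4 * t * F * s ≤ 2 * (1 + 2 * S ^ 2 - (1 - 2 * s ^ 2)) := by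
    nlinarith [sq_nonneg (S - s), mul_le_mul_of_nonneg_right hS hs0.le]
  have b2 : 2 * |x| * s = 1 / π * E * (4 * t * F * s) := by
    have : 1 / π * E * (4 * t * F * s) = 1 / π * (E * F) * (4 * t * s) := by ring
    rw [this, hE, ht]
    have := Real.pi_pos
    field_simp; ring
  have hx := abs_nonneg x
  calc |x| * (2 * s * c) ≤ 2 * |x| * s := by nlinarith [mul_nonneg hx hs0.le]
    _ ≤ _ := by
      rw [b2]
      exact mul_le_mul_of_nonneg_left b1 (by have := Real.pi_pos; positivity)

def U (α w : ℝ) : ℝ := Real.log (Pker α w / (1 - α))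

lemma U_cont {α : ℝ} (hα : α ∈ Set.Ioo (0:ℝ) 1) : Continuous (U α) := by
  unfold U
  refine Continuous.log ((Pker_cont hα).div_const _) ?_
  intro x
  have := Pker_pos hα x
  have := hα.2
  exact (div_pos (Pker_pos hα x) (by linarith)).ne'

lemma U_bound {α : ℝ} (hα : α ∈ Set.Ioo (0:ℝ) 1) :
    ∃ C, 0 ≤ C ∧ ∀ w, |(U α w + π * |w|)| ≤ C := by
  have hs := sinpos hα
  have h1 : 0 < 1 - α := by linarith [hα.2]
  have he := abs_cos_lt hα
  set e := 1 - |Real.cos (π * α)| with hedef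
  have key : ∀ w, U α w = Real.log (Real.sin (π * α) / (2 * (1 - α)))
      - Real.log (Real.cosh (π * w) - Real.cos (π * α)) := by
    intro w
    have hN := N_pos hα w
    rw [← Real.log_div (by positivity) hN.ne']
    unfold U Pker
    congr 1
    field_simp
  set A := Real.log (Real.sin (π * α) / (2 * (1 - α)))
  refine ⟨|A| + |Real.log (e / 2)| + |Real.log 2|, by positivity, fun w => ?_⟩
  rw [key]
  have hN := N_pos hα w
  have l1 : Real.log (e / 2) + π * |w| ≤ Real.log (Real.cosh (π * w) - Real.cos (π * α)) := by
    rw [← Real.log_exp (π * |w|), ← Real.log_mul (by positivity) (Real.exp_pos _).ne']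
    exact Real.log_le_log (by positivity) (N_ge_exp he le_rfl w)
  have l2 : Real.log (Real.cosh (π * w) - Real.cos (π * α)) ≤ Real.log 2 + π * |w| := by
    rw [← Real.log_exp (π * |w|), ← Real.log_mul (by positivity) (Real.exp_pos _).ne']
    refine Real.log_le_log hN ?_
    have a := cosh_le_exp_abs (π * w)
    rw [abs_mul, abs_of_pos Real.pi_pos] at a
    have b := Real.neg_one_le_cos (π * α)
    have c := Real.one_le_exp (show 0 ≤ π * |w| by positivity)
    linarith
  have a1 := le_abs_self A
  have a2 := neg_abs_le A
  have a3 := le_abs_self (Real.log (e/2))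
  have a4 := neg_abs_le (Real.log (e/2))
  have a5 := le_abs_self (Real.log 2)
  have a6 := neg_abs_le (Real.log 2)
  rw [abs_le]; constructor <;> linarith

lemma U_exp {α : ℝ} (hα : α ∈ Set.Ioo (0:ℝ) 1) :
    ∃ C, 0 ≤ C ∧ ∀ w, |U α w| ≤ C * Real.exp |w| := by
  obtain ⟨C, hC, h⟩ := U_bound hα
  refine ⟨C + π, by positivity, fun w => ?_⟩
  have h1 := abs_sub (U α w + π * |w|) (π * |w|)
  rw [add_sub_cancel_right, abs_mul, abs_abs, abs_of_pos Real.pi_pos] at h1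
  have h2 := Real.add_one_le_exp |w|
  have h3 := abs_nonneg w
  have h4 := h w
  have h5 := Real.pi_pos
  nlinarith

lemma conv_integrable {α y : ℝ} (hα : α ∈ Set.Ioo (0:ℝ) 1) (hy : y ∈ Set.Ioo (0:ℝ) 1) (x : ℝ) :
    Integrable (fun w => Pker y (x - w) * U α w) := by
  obtain ⟨C, hC, h⟩ := U_exp hα
  have he := abs_cos_lt hy
  set e := 1 - |Real.cos (π * y)| with hedef
  refine ((integrable_expabs 2 (by norm_num)).const_mul (e⁻¹ * Real.exp (π * |x|) * C)).mono'
    (((Pker_cont hy).comp (by fun_prop)).mul (U_cont hα)).aestronglyMeasurable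
    (ae_of_all _ fun w => ?_)
  rw [norm_mul, Real.norm_of_nonneg (Pker_pos hy _).le, Real.norm_eq_abs]
  calc _ ≤ (e⁻¹ * Real.exp (-π * |x - w|)) * (C * Real.exp |w|) :=
        mul_le_mul (Pker_le hy _) (h w) (abs_nonneg _) (by positivity)
    _ = e⁻¹ * C * (Real.exp (-π * |x - w|) * Real.exp |w|) := by ring
    _ ≤ e⁻¹ * C * (Real.exp (π * |x|) * Real.exp (-2 * |w|)) := by
      refine mul_le_mul_of_nonneg_left ?_ (by positivity)
      rw [← Real.exp_add, ← Real.exp_add]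
      refine Real.exp_le_exp.2 ?_
      have h1 : |w| ≤ |x| + |x - w| := by
        have := abs_sub x (x - w); simpa using this
      have h3 := Real.pi_gt_three
      nlinarith [abs_nonneg w]
    _ = _ := by ring

lemma conv_bound {α : ℝ} (hα : α ∈ Set.Ioo (0:ℝ) 1) :
    ∃ C, ∀ x y : ℝ, y ∈ Set.Ioo (0:ℝ) 1 →
      |((∫ w, Pker y (x - w) * U α w) + π * (1 - y) * |x|)| ≤ C := by
  obtain ⟨C, hC, h⟩ := U_bound hα
  refine ⟨C + π * ∫ w, (1 / π) * Real.exp (-(π / 4) * |w|), fun x y hy => ?_⟩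
  have hI := conv_integrable hα hy x
  have hP : Integrable (fun w => Pker y (x - w)) := (Pker_integrable hy).comp_sub_left x
  have hP1 : ∫ w, Pker y (x - w) = 1 - y := by
    rw [integral_sub_left_eq_self (Pker y), Pker_integral hy]
  have hE := ((integrable_expabs (π / 4) (by positivity)).const_mul (1 / π))
  have e1 : (∫ w, Pker y (x - w) * U α w) + π * (1 - y) * |x|
      = ∫ w, Pker y (x - w) * (U α w + π * |x|) := by
    have : ∀ w, Pker y (x - w) * (U α w + π * |x|)
      = Pker y (x - w) * U α w + Pker y (x - w) * (π * |x|) := fun w => by ring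
    simp_rw [this]
    rw [integral_add hI (hP.mul_const _), integral_mul_const, hP1]; ring
  rw [e1, ← Real.norm_eq_abs]
  have hE' := hE.comp_sub_left x
  have hg : Integrable (fun w => C * Pker y (x - w)
      + π * ((1 / π) * Real.exp (-(π / 4) * |x - w|))) := (hP.const_mul C).add (hE'.const_mul π)
  refine (norm_integral_le_of_norm_le hg (ae_of_all _ fun w => ?_)).trans ?_
  · rw [norm_mul, Real.norm_of_nonneg (Pker_pos hy _).le, Real.norm_eq_abs]
    have h1 := mul_Pker_le hy (x - w)
    have h2 : |(U α w + π * |x|)| ≤ C + π * |x - w| := by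
      have a : U α w + π * |x| = (U α w + π * |w|) + π * (|x| - |w|) := by ring
      rw [a]
      refine (abs_add_le _ _).trans (add_le_add (h w) ?_)
      rw [abs_mul, abs_of_pos Real.pi_pos]
      exact mul_le_mul_of_nonneg_left (abs_abs_sub_abs_le _ _) Real.pi_pos.le
    have h3 := (Pker_pos hy (x - w)).le
    have := Real.pi_pos
    nlinarith [mul_le_mul_of_nonneg_left h2 h3, mul_le_mul_of_nonneg_left h1 this.le]
  · rw [integral_add (hP.const_mul C) (hE'.const_mul π), integral_const_mul, hP1,
      integral_const_mul, integral_sub_left_eq_self (fun w => (1 / π) * Real.exp (-(π / 4) * |w|))]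
    nlinarith [hy.1]

def KK (z : ℂ) : ℂ := I / 2 * (cosh (π * z / 2) / sinh (π * z / 2))

lemma sinh_parts (z : ℂ) : sinh (π * z / 2) =
    (Real.sinh (π * z.re / 2) * Real.cos (π * z.im / 2) : ℝ)
      + (Real.cosh (π * z.re / 2) * Real.sin (π * z.im / 2) : ℝ) * I := by
  conv_lhs => rw [← re_add_im z]
  rw [show (π * ((z.re : ℂ) + z.im * I) / 2 : ℂ)
    = ((π * z.re / 2 : ℝ) : ℂ) + ((π * z.im / 2 : ℝ) : ℂ) * I by push_cast; ring]
  rw [Complex.sinh_add, Complex.cosh_mul_I, Complex.sinh_mul_I]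
  push_cast; ring

lemma cosh_parts (z : ℂ) : cosh (π * z / 2) =
    (Real.cosh (π * z.re / 2) * Real.cos (π * z.im / 2) : ℝ)
      + (Real.sinh (π * z.re / 2) * Real.sin (π * z.im / 2) : ℝ) * I := by
  conv_lhs => rw [← re_add_im z]
  rw [show (π * ((z.re : ℂ) + z.im * I) / 2 : ℂ)
    = ((π * z.re / 2 : ℝ) : ℂ) + ((π * z.im / 2 : ℝ) : ℂ) * I by push_cast; ring]
  rw [Complex.cosh_add, Complex.cosh_mul_I, Complex.sinh_mul_I]
  push_cast; ring

lemma N_half (x y : ℝ) : Real.cosh (π * x) - Real.cos (π * y)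
    = 2 * (Real.sinh (π * x / 2) ^ 2 + Real.sin (π * y / 2) ^ 2) := by
  rw [show π * x = 2 * (π * x / 2) by ring, show π * y = 2 * (π * y / 2) by ring,
    Real.cosh_two_mul, Real.cos_two_mul, Real.cos_sq', Real.cosh_sq]
  ring_nf

lemma normSq_sinh (z : ℂ) : normSq (sinh (π * z / 2))
    = (Real.cosh (π * z.re) - Real.cos (π * z.im)) / 2 := by
  rw [sinh_parts, normSq_add_mul_I, N_half, mul_pow, mul_pow, Real.cosh_sq, Real.cos_sq']
  ring

lemma KK_re (z : ℂ) : (KK z).re = Pker z.im z.re := by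
  unfold KK Pker
  rw [N_half]
  have h : I / 2 * (cosh (π * z / 2) / sinh (π * z / 2))
    = (I / 2 * cosh (π * z / 2)) / sinh (π * z / 2) := by ring
  rw [h, div_re, normSq_sinh, N_half, sinh_parts, cosh_parts,
    show π * z.im = 2 * (π * z.im / 2) by ring, Real.sin_two_mul]
  have h1 := Real.cosh_sq (π * z.re / 2)
  generalize π * z.re / 2 = a at *
  rw [show 2 * (π * z.im / 2) / 2 = π * z.im / 2 by ring]
  generalize π * z.im / 2 = b at *
  have e1 : ∀ A B : ℝ, (I / 2 * ((A : ℂ) + B * I)).re = -B / 2 := by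
    intro A B
    rw [show (I / 2 * ((A : ℂ) + B * I)) = ((-B / 2 : ℝ) : ℂ) + ((A / 2 : ℝ) : ℂ) * I by
      push_cast; linear_combination (B / 2 : ℂ) * I_sq]
    simp
  have e2 : ∀ A B : ℝ, (I / 2 * ((A : ℂ) + B * I)).im = A / 2 := by
    intro A B
    rw [show (I / 2 * ((A : ℂ) + B * I)) = ((-B / 2 : ℝ) : ℂ) + ((A / 2 : ℝ) : ℂ) * I by
      push_cast; linear_combination (B / 2 : ℂ) * I_sq]
    simp
  have e3 : ∀ A B : ℝ, ((A : ℂ) + B * I).re = A := by intro A B; simp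
  have e4 : ∀ A B : ℝ, ((A : ℂ) + B * I).im = B := by intro A B; simp
  rw [e1, e2, e3, e4, ← add_div]
  generalize Real.sinh a ^ 2 + Real.sin b ^ 2 = D
  have : -(Real.sinh a * Real.sin b) / 2 * (Real.sinh a * Real.cos b)
    + Real.cosh a * Real.cos b / 2 * (Real.cosh a * Real.sin b) = Real.sin b * Real.cos b / 2 := by
    linear_combination (Real.sin b * Real.cos b / 2) * h1
  rw [this]
  by_cases hD : D = 0
  · simp [hD]
  · field_simp

lemma sinh_ne {z : ℂ} (h : 0 < 1 - |Real.cos (π * z.im)|) : sinh (π * z / 2) ≠ 0 := by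
  rw [← normSq_pos, normSq_sinh]
  have h1 := N_ge_exp h le_rfl z.re
  have h3 := Real.exp_pos (π * |z.re|)
  nlinarith [mul_pos h h3]

lemma KK_deriv {z : ℂ} (h : sinh (π * z / 2) ≠ 0) :
    HasDerivAt KK (-(I * π / 4) / sinh (π * z / 2) ^ 2) z := by
  have h0 : HasDerivAt (fun z : ℂ => (π : ℂ) * z / 2) (π * 1 / 2) z :=
    ((hasDerivAt_id z).const_mul (π : ℂ)).div_const 2
  have h1 := ((h0.ccosh.div h0.csinh h).const_mul (I / 2))
  refine h1.congr_deriv ?_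
  have h2 := Complex.cosh_sq (π * z / 2)
  field_simp
  linear_combination (-4) * h2

lemma KK_sub {a b : ℂ} (ha : sinh (π * a / 2) ≠ 0) (hb : sinh (π * b / 2) ≠ 0) :
    KK a - KK b = I / 2 * sinh (π * (b - a) / 2) * ((sinh (π * a / 2))⁻¹ * (sinh (π * b / 2))⁻¹) := by
  unfold KK
  rw [show π * (b - a) / 2 = π * b / 2 - π * a / 2 by ring, Complex.sinh_sub]
  field_simp

lemma inv_sinh_bound {z : ℂ} {e R : ℝ} (he0 : 0 < e) (he : e ≤ 1 - |Real.cos (π * z.im)|)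
    (hR : |z.re| ≤ R) (w : ℝ) :
    ‖(sinh (π * (z - w) / 2))⁻¹‖ ^ 2 ≤ 4 / e * Real.exp (π * R) * Real.exp (-π * |w|) := by
  rw [norm_inv, inv_pow, ← normSq_eq_norm_sq, normSq_sinh]
  have h := N_ge_exp (y := (z - w).im) he0 (by simpa using he) (z - w).re
  have h2 : 0 < e / 4 * Real.exp (π * |(z - w).re|) := by positivity
  calc _ ≤ (e / 4 * Real.exp (π * |(z - w).re|))⁻¹ := inv_anti₀ h2 (by linarith)
    _ = 4 / e * Real.exp (-(π * |(z - w).re|)) := by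
      rw [mul_inv, Real.exp_neg, inv_div]
    _ ≤ 4 / e * (Real.exp (π * R) * Real.exp (-π * |w|)) := by
      refine mul_le_mul_of_nonneg_left ?_ (by positivity)
      rw [← Real.exp_add]
      refine Real.exp_le_exp.2 ?_
      have h1 : |w| ≤ |z.re| + |z.re - w| := by
        have := abs_sub z.re (z.re - w); simpa using this
      have : (z - w).re = z.re - w := by simp
      rw [this]
      nlinarith [Real.pi_pos]
    _ = _ := by ring

def FF (α : ℝ) (z : ℂ) (w : ℝ) : ℂ :=
  (KK (z - w) - KK (α * I - w) + (Pker α (-w) : ℝ)) * (U α w : ℝ)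

def AA (α : ℝ) (z : ℂ) : ℂ := ∫ w, FF α z w

lemma KK_contw {z : ℂ} (h : 0 < 1 - |Real.cos (π * z.im)|) :
    Continuous (fun w : ℝ => KK (z - w)) := by
  unfold KK
  refine continuous_const.mul (Continuous.div (by fun_prop) (by fun_prop) fun w => ?_)
  exact sinh_ne (z := z - w) (by simpa using h)

lemma FF_cont {α : ℝ} (hα : α ∈ Set.Ioo (0:ℝ) 1) {z : ℂ} (h : 0 < 1 - |Real.cos (π * z.im)|) :
    Continuous (FF α z) := by
  unfold FF
  have h1 := KK_contw h
  have h2 := KK_contw (z := α * I) (by simpa using abs_cos_lt hα)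
  have h3 := U_cont hα
  have h4 := Pker_cont hα
  have h5 : Continuous fun w : ℝ => Pker α (-w) := h4.comp continuous_neg
  exact ((h1.sub h2).add (continuous_ofReal.comp h5)).mul (continuous_ofReal.comp h3)

lemma FF_integrable {α : ℝ} (hα : α ∈ Set.Ioo (0:ℝ) 1) {z : ℂ}
    (h : 0 < 1 - |Real.cos (π * z.im)|) : Integrable (FF α z) := by
  obtain ⟨C, hC, hU⟩ := U_exp hα
  have hα' : 0 < 1 - |Real.cos (π * ((α : ℂ) * I).im)| := by simpa using abs_cos_lt hα
  set D := ‖I / 2 * sinh (π * ((α : ℂ) * I - z) / 2)‖ with hD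
  have hP := conv_integrable hα hα 0
  have hmain : Integrable (fun w : ℝ => (KK (z - w) - KK (α * I - w)) * (U α w : ℝ)) := by
    refine ((integrable_expabs 2 (by norm_num)).const_mul (D * (4 / (1 - |Real.cos (π * z.im)|)
      * Real.exp (π * |z.re|) + 4 / (1 - |Real.cos (π * ((α : ℂ) * I).im)|)
        * Real.exp (π * |((α : ℂ) * I).re|)) * C)).mono'
      (((KK_contw h).sub (KK_contw hα')).mul
        (continuous_ofReal.comp (U_cont hα))).aestronglyMeasurable (ae_of_all _ fun w => ?_)
    have b1 := inv_sinh_bound h le_rfl le_rfl w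
    have b2 := inv_sinh_bound hα' le_rfl le_rfl w
    rw [norm_mul, KK_sub (sinh_ne (by simpa using h)) (sinh_ne (by simpa using hα')),
      norm_mul, norm_real, Real.norm_eq_abs, norm_mul (sinh _)⁻¹, sub_sub_sub_cancel_right, ← hD]
    set X := ‖(sinh (π * (z - w) / 2))⁻¹‖
    set Y := ‖(sinh (π * (α * I - w) / 2))⁻¹‖
    set M := 4 / (1 - |Real.cos (π * z.im)|) * Real.exp (π * |z.re|)
    set M' := 4 / (1 - |Real.cos (π * ((α : ℂ) * I).im)|) * Real.exp (π * |((α : ℂ) * I).re|)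
    have hXY : X * Y ≤ (M + M') * Real.exp (-π * |w|) := by
      nlinarith [sq_nonneg (X - Y), sq_nonneg (X + Y)]
    have hM : 0 ≤ M + M' := by positivity
    have hDn : 0 ≤ D := norm_nonneg _
    calc D * (X * Y) * |U α w| ≤ D * ((M + M') * Real.exp (-π * |w|)) * (C * Real.exp |w|) :=
          mul_le_mul (mul_le_mul_of_nonneg_left hXY hDn) (hU w) (abs_nonneg _) (by positivity)
      _ = D * (M + M') * C * (Real.exp (-π * |w|) * Real.exp |w|) := by ring
      _ ≤ _ := by
        refine mul_le_mul_of_nonneg_left ?_ (by positivity)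
        rw [← Real.exp_add]
        refine Real.exp_le_exp.2 ?_
        nlinarith [Real.pi_gt_three, abs_nonneg w]
  have := hmain.add (Integrable.ofReal (𝕜 := ℂ) hP)
  refine this.congr (ae_of_all _ fun w => ?_)
  simp only [FF, Pi.add_apply, zero_sub, coe_algebraMap, RCLike.ofReal_mul]
  ring_nf
  try simp
  try ring

lemma AA_diff {α : ℝ} (hα : α ∈ Set.Ioo (0:ℝ) 1) {z : ℂ}
    (h : 0 < 1 - |Real.cos (π * z.im)|) : DifferentiableAt ℂ (AA α) z := by
  obtain ⟨C, hC, hU⟩ := U_exp hα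
  set e := (1 - |Real.cos (π * z.im)|) / 2 with he
  have he0 : 0 < e := by positivity
  set R := |z.re| + 1 with hR
  set s : Set ℂ := {x | e < 1 - |Real.cos (π * x.im)| ∧ |x.re| < R} with hs
  have hsn : s ∈ 𝓝 z := by
    refine IsOpen.mem_nhds ?_ ⟨by linarith, by linarith⟩
    have c1 : Continuous fun x : ℂ => 1 - |Real.cos (π * x.im)| := by fun_prop
    have c2 : Continuous fun x : ℂ => |x.re| := by fun_prop
    exact (isOpen_lt continuous_const c1).inter (isOpen_lt c2 continuous_const)
  have key := hasDerivAt_integral_of_dominated_loc_of_deriv_le (μ := volume) (F := FF α)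
    (F' := fun x w => (-(I * π / 4) / sinh (π * (x - w) / 2) ^ 2) * (U α w : ℝ))
    (bound := fun w => (π / 4 * (4 / e * Real.exp (π * R)) * C) * Real.exp (-2 * |w|))
    hsn ?_ (FF_integrable hα h) ?_ ?_ ((integrable_expabs 2 (by norm_num)).const_mul _) ?_
  · exact key.2.differentiableAt
  · filter_upwards [hsn] with x hx
    exact (FF_cont hα (he0.trans hx.1)).aestronglyMeasurable
  · refine Continuous.aestronglyMeasurable ?_
    refine Continuous.mul ?_ (continuous_ofReal.comp (U_cont hα))
    refine Continuous.div (by fun_prop) (by fun_prop) fun w => pow_ne_zero 2 ?_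
    exact sinh_ne (z := z - w) (by simpa using h)
  · refine ae_of_all _ fun w x hx => ?_
    have b1 := inv_sinh_bound he0 hx.1.le hx.2.le w
    rw [norm_mul, norm_real, Real.norm_eq_abs, div_eq_mul_inv, norm_mul, ← inv_pow, norm_pow]
    have : ‖-(I * π / 4)‖ = π / 4 := by
      simp [abs_of_pos Real.pi_pos]
    rw [this]
    calc _ ≤ π / 4 * (4 / e * Real.exp (π * R) * Real.exp (-π * |w|)) * (C * Real.exp |w|) :=
          mul_le_mul (mul_le_mul_of_nonneg_left b1 (by positivity)) (hU w) (abs_nonneg _)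
            (by positivity)
      _ = (π / 4 * (4 / e * Real.exp (π * R)) * C) * (Real.exp (-π * |w|) * Real.exp |w|) := by ring
      _ ≤ _ := by
        refine mul_le_mul_of_nonneg_left ?_ (by positivity)
        rw [← Real.exp_add]
        refine Real.exp_le_exp.2 ?_
        nlinarith [Real.pi_gt_three, abs_nonneg w]
  · refine ae_of_all _ fun w x hx => ?_
    have h1 : HasDerivAt (fun x : ℂ => KK (x - w)) (-(I * π / 4) / sinh (π * (x - w) / 2) ^ 2) x :=
      (KK_deriv (z := x - w) (sinh_ne (by simpa using he0.trans hx.1))).comp_sub_const x (w : ℂ)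
    exact ((h1.sub_const _).add_const _).mul_const _

lemma AA_re {α : ℝ} (hα : α ∈ Set.Ioo (0:ℝ) 1) {z : ℂ} (h : 0 < 1 - |Real.cos (π * z.im)|) :
    (AA α z).re = ∫ w, Pker z.im (z.re - w) * U α w := by
  unfold AA
  have := integral_re (𝕜 := ℂ) (FF_integrable hα h)
  simp only [RCLike.re_eq_complex_re] at this
  rw [← this]
  congr 1
  ext w
  unfold FF
  rw [re_mul_ofReal, add_re, sub_re, KK_re, KK_re]
  simp

lemma AA_im (α : ℝ) : (AA α (α * I)).im = 0 := by
  unfold AA FF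
  simp only [sub_self, zero_add, ← ofReal_mul]
  rw [integral_complex_ofReal, ofReal_im]

lemma U_even (α w : ℝ) : U α (-w) = U α w := by simp [U, Pker]

lemma Pker_even (y x : ℝ) : Pker y (-x) = Pker y x := by simp [Pker]

lemma conv_even (α y x : ℝ) :
    ∫ w, Pker y (-x - w) * U α w = ∫ w, Pker y (x - w) * U α w := by
  rw [← integral_neg_eq_self]
  congr 1
  ext w
  rw [U_even, ← Pker_even]
  congr 2; ring

lemma strip_e {z : ℂ} (hz : z ∈ Strip) : 0 < 1 - |Real.cos (π * z.im)| := abs_cos_lt ⟨hz.1, hz.2⟩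

lemma strip_open : IsOpen Strip :=
  (isOpen_lt continuous_const continuous_im).inter (isOpen_lt continuous_im continuous_const)

lemma strip_conn : IsConnected Strip := by
  refine ⟨⟨(1 / 2 : ℝ) * I, by constructor <;> simp <;> norm_num⟩, ?_⟩
  have : Convex ℝ Strip :=
    (convex_halfSpace_im_gt 0).inter (convex_halfSpace_im_lt 1)
  exact this.isPreconnected

/-- **Construction of optimizers** (Lemma 4.3): existence and uniqueness of the phase
function `φ_{α,p,q}`, together with the linear decay of its real part. -/
theorem phase_function (α : ℝ) (hα : α ∈ Set.Ioo (0:ℝ) 1) (p q : ℝ≥0∞)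
    (hp : 1 ≤ p) (hq : 1 ≤ q) :
    ∃ φ : ℂ → ℂ, DifferentiableOn ℂ φ Strip ∧ (φ ((α : ℂ) * Complex.I)).im = 0 ∧
      ReFormula p q α φ ∧
      (∀ ψ : ℂ → ℂ, DifferentiableOn ℂ ψ Strip → (ψ ((α : ℂ) * Complex.I)).im = 0 →
        ReFormula p q α ψ → ∀ z ∈ Strip, ψ z = φ z) ∧
      ∃ C : ℝ, ∀ x y : ℝ, y ∈ Set.Ioo (0:ℝ) 1 →
        ‖(φ ((x : ℂ) + (y : ℂ) * Complex.I)).re +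
            Real.pi * ((1 - y) * (p⁻¹).toReal + y * (q⁻¹).toReal) * |x|‖ ≤ C := by
  have hα1 : 1 - α ∈ Set.Ioo (0:ℝ) 1 := ⟨by linarith [hα.2], by linarith [hα.1]⟩
  set a := (p⁻¹).toReal with ha
  set b := (q⁻¹).toReal with hb
  have ha0 : 0 ≤ a := ENNReal.toReal_nonneg
  have hb0 : 0 ≤ b := ENNReal.toReal_nonneg
  set φ : ℂ → ℂ := fun z => a * AA α z + b * AA (1 - α) (I - z) with hφ
  have hrefl : ∀ z ∈ Strip, I - z ∈ Strip := fun z hz => by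
    constructor <;> simp <;> linarith [hz.1, hz.2]
  have hmem : ∀ x y : ℝ, y ∈ Set.Ioo (0:ℝ) 1 → (x : ℂ) + y * I ∈ Strip := fun x y hy => by
    constructor <;> simp [hy.1, hy.2]
  have hre : ∀ x y : ℝ, y ∈ Set.Ioo (0:ℝ) 1 → (φ ((x : ℂ) + (y : ℂ) * I)).re =
      a * (∫ w, Pker y (x - w) * U α w) + b * (∫ w, Pker (1 - y) (x - w) * U (1 - α) w) := by
    intro x y hy
    have hz := hmem x y hy
    simp only [hφ]
    rw [add_re, re_ofReal_mul, re_ofReal_mul, AA_re hα (strip_e hz),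
      AA_re hα1 (strip_e (hrefl _ hz)), ← conv_even (1 - α)]
    simp
  have hdiff : DifferentiableOn ℂ φ Strip := by
    intro z hz
    have h1 := AA_diff hα (strip_e hz)
    have h2 := AA_diff hα1 (strip_e (hrefl z hz))
    have h3 : DifferentiableAt ℂ (fun z => AA (1 - α) (I - z)) z :=
      DifferentiableAt.comp (g := AA (1 - α)) (f := fun z => I - z) z h2 (by fun_prop)
    exact ((h1.const_mul _).add (h3.const_mul _)).differentiableWithinAt
  have him : (φ ((α : ℂ) * I)).im = 0 := by
    simp only [hφ]
    rw [add_im, im_ofReal_mul, im_ofReal_mul, AA_im,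
      show I - (α : ℂ) * I = ((1 - α : ℝ) : ℂ) * I by push_cast; ring, AA_im]
    simp
  have hF : ReFormula p q α φ := by
    intro x y hy
    rw [hre x y hy]
    simp only [U, sub_sub_cancel, ← ha, ← hb]
  refine ⟨φ, hdiff, him, hF, ?_, ?_⟩
  · intro ψ hψ hψi hψF z hz
    have han : AnalyticOnNhd ℂ (fun z => ψ z - φ z) Strip :=
      (hψ.sub hdiff).analyticOnNhd strip_open
    obtain ⟨c, hc⟩ := han.eq_const_of_re_eq_const (c₀ := 0) (fun z hz => by
      have e := re_add_im z
      have h1 := hψF z.re z.im ⟨hz.1, hz.2⟩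
      have h2 := hF z.re z.im ⟨hz.1, hz.2⟩
      rw [e] at h1 h2
      rw [sub_re, h1, h2, sub_self]) strip_open strip_conn
    have hαS : (α : ℂ) * I ∈ Strip := by simpa using hmem 0 α hα
    have hc0 : c = 0 := by
      apply Complex.ext
      · have h1 := hψF 0 α hα
        have h2 := hF 0 α hα
        simp only [ofReal_zero, zero_add] at h1 h2
        rw [← hc _ hαS, sub_re, h1, h2, sub_self, zero_re]
      · rw [← hc _ hαS, sub_im, hψi, him, sub_self, zero_im]
    exact sub_eq_zero.1 ((hc z hz).trans hc0)
  · obtain ⟨C1, h1⟩ := conv_bound hα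
    obtain ⟨C2, h2⟩ := conv_bound hα1
    refine ⟨a * C1 + b * C2, fun x y hy => ?_⟩
    rw [hre x y hy, Real.norm_eq_abs]
    have k1 := h1 x y hy
    have k2 := h2 x (1 - y) ⟨by linarith [hy.2], by linarith [hy.1]⟩
    rw [abs_le] at k1 k2 ⊢
    constructor
    · nlinarith [mul_le_mul_of_nonneg_left k1.1 ha0, mul_le_mul_of_nonneg_left k2.1 hb0]
    · nlinarith [mul_le_mul_of_nonneg_left k1.2 ha0, mul_le_mul_of_nonneg_left k2.2 hb0]
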